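/- arXiv:1803.08520 — 2 statements merged into one kernel-verified Lean document; each statement's English description precedes it below -/
import Mathlib

section
/- Assume the Hypothesis. Then for every nonzero a ∈ K and x ∈ O, −f(a)²x + f(a)x + f(a) ∈ f(K). -/
open scoped Classical

/-- The cross-ratio `[a,b;c,d]` on the projective line `F ∪ {∞}` (modelled as
`Option F`, with `none` playing the role of `∞`), with the usual conventions
at `∞`; junk value `0` when two or more of the arguments are `∞`. -/
noncomputable def crossRatio {F : Type*} [Field F] :
    Option F → Option F → Option F → Option F → F
  | none,   some b, some c, some d => (d - b) / (c - b)
  | some a, none,   some c, some d => (c - a) / (d - a)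
  | some a, some b, none,   some d => (d - b) / (d - a)
  | some a, some b, some c, none   => (c - a) / (c - b)
  | some a, some b, some c, some d => ((c - a) / (c - b)) * ((d - b) / (d - a))
  | _, _, _, _ => 0

/-- A permutation `f` of the projective line is `O`-preserving if for all
quadruples of distinct points, `[a,b;c,d] ∈ O ↔ [f a, f b; f c, f d] ∈ O`. -/
def OPreserving {F : Type*} [Field F] (O : Set F) (f : Equiv.Perm (Option F)) : Prop :=
  ∀ a b c d : Option F, a ≠ b → a ≠ c → a ≠ d → b ≠ c → b ≠ d → c ≠ d →
    (crossRatio a b c d ∈ O ↔ crossRatio (f a) (f b) (f c) (f d) ∈ O)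

/-- The map `F → F` induced by a permutation of `F ∪ {∞}` fixing `∞`
(junk value `0` if `f` maps a finite point to `∞`). -/
noncomputable def fmap {F : Type*} [Field F] (f : Equiv.Perm (Option F)) (a : F) : F :=
  (f (some a)).getD 0

/-- A permutation of the projective line fixing `∞` hits every finite point at a finite point. -/
theorem exists_some_of_fix_none {F : Type*} (f : Equiv.Perm (Option F))
    (hinf : f none = none) (y : F) : ∃ c, f (some c) = some y := by
  obtain ⟨o, ho⟩ := f.surjective (some y)
  cases o with
  | none => simp [hinf] at ho
  | some c => exact ⟨c, ho⟩

/-- A permutation of the projective line fixing `∞` agrees with `fmap f` at finite points. -/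
theorem apply_some_eq_fmap {F : Type*} [Field F] (f : Equiv.Perm (Option F))
    (hinf : f none = none) (a : F) : f (some a) = some (fmap f a) := by
  unfold fmap
  cases h : f (some a) with
  | none => exact absurd (f.injective (h.trans hinf.symm)) (by simp)
  | some y => rfl

/-- A subfield containing the finite points `a`, `c`, `d` and their cross-ratio with `e`
contains `e`. -/
theorem mem_of_crossRatio_mem {F : Type*} [Field F] (K : Subfield F) {a c d e : F}
    (ha : a ∈ K) (hc : c ∈ K) (hd : d ∈ K) (hac : a ≠ c) (had : a ≠ d) (hce : c ≠ e)
    (hcd : c ≠ d) (h : crossRatio (some a) (some c) (some e) (some d) ∈ K) : e ∈ K := by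
  set y := crossRatio (some a) (some c) (some e) (some d) with hy
  have h1 : e - c ≠ 0 := sub_ne_zero.2 hce.symm
  have h2 : d - a ≠ 0 := sub_ne_zero.2 had.symm
  have h3 : d - c ≠ 0 := sub_ne_zero.2 hcd.symm
  have key : (e - a) * (d - c) = y * ((e - c) * (d - a)) := by
    rw [hy]
    simp only [crossRatio]
    field_simp
  have hD : (d - c) - y * (d - a) ≠ 0 := by
    intro hD
    have : (c - a) * (d - c) = 0 := by linear_combination key - (e - c) * hD
    exact (mul_ne_zero (sub_ne_zero.2 hac.symm) h3) this
  have he : e = (a * (d - c) - y * (d - a) * c) / ((d - c) - y * (d - a)) := by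
    rw [eq_div_iff hD]
    linear_combination key
  rw [he]
  exact K.div_mem
    (K.sub_mem (K.mul_mem ha (K.sub_mem hd hc)) (K.mul_mem (K.mul_mem h (K.sub_mem hd ha)) hc))
    (K.sub_mem (K.sub_mem hd hc) (K.mul_mem h (K.sub_mem hd ha)))

/-- Here `Subfield.closure O` is the subfield `K = k(O)` of `F` generated by `O`
(over the prime field `k`), and `fmap f '' K` is the image `f(K)` of `K` under `f`. -/
theorem second_closure_one {F : Type*} [Field F]
    (O : Set F) (hne : O.Nonempty) (hO : ∀ x ∈ O, x ≠ 0 ∧ x ≠ 1)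
    (f : Equiv.Perm (Option F)) (hf : OPreserving O f)
    (hinf : f none = none) (h0 : f (some 0) = some 0) (h1 : f (some 1) = some 1) :
    ∀ a ∈ Subfield.closure O, a ≠ 0 → ∀ x ∈ O,
      -(fmap f a) ^ 2 * x + fmap f a * x + fmap f a ∈ fmap f '' (Subfield.closure O : Set F) := by
  intro a ha ha0 x hx
  obtain ⟨hx0, hx1⟩ := hO x hx
  have hfa := apply_some_eq_fmap f hinf a
  set b := fmap f a with hb
  have hb0 : b ≠ 0 := by
    intro h
    rw [h, ← h0] at hfa
    exact ha0 (Option.some.inj (f.injective hfa))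
  have hf1 : fmap f 1 = 1 := by simp [fmap, h1]
  by_cases hb1 : b = 1
  · exact ⟨1, one_mem _, by rw [hf1, hb1]; ring⟩
  by_cases hbx1 : b * x = 1
  · exact ⟨1, one_mem _, by rw [hf1]; linear_combination (b - 1) * hbx1⟩
  have hbbx : b ≠ b * x := fun h => hx1 (mul_left_cancel₀ hb0 (by rw [← h, mul_one]))
  have hne_of {u v p q : F} (hu : f (some u) = some p) (hv : f (some v) = some q)
      (hpq : p ≠ q) : u ≠ v := by
    rintro rfl
    exact hpq (Option.some.inj (hu.symm.trans hv))
  obtain ⟨c, hc⟩ := exists_some_of_fix_none f hinf (b * x)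
  have hac : a ≠ c := hne_of hfa hc hbbx
  have hc0 : (0 : F) ≠ c := hne_of h0 hc (mul_ne_zero hb0 hx0).symm
  have hc1 : c ≠ 1 := hne_of hc h1 hbx1
  have ha1 : a ≠ 1 := hne_of hfa h1 hb1
  have hcK : c ∈ Subfield.closure O := by
    have h := (hf none (some 0) (some a) (some c) (by simp) (by simp) (by simp)
      (by simpa using ha0.symm) (by simpa using hc0) (by simpa using hac)).2 (by
        rw [hinf, h0, hfa, hc]
        simpa [crossRatio, mul_div_cancel_left₀ x hb0] using hx)
    have h' : c / a ∈ Subfield.closure O :=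
      Subfield.subset_closure (by simpa [crossRatio] using h)
    simpa [div_mul_cancel₀ c ha0] using mul_mem h' ha
  obtain ⟨e, he⟩ := exists_some_of_fix_none f hinf (-b ^ 2 * x + b * x + b)
  have s1 : 1 - b ≠ 0 := sub_ne_zero.2 (Ne.symm hb1)
  have s2 : 1 - b * x ≠ 0 := sub_ne_zero.2 (Ne.symm hbx1)
  have tb : -b ^ 2 * x + b * x + b - b = b * x * (1 - b) := by ring
  have tbx : -b ^ 2 * x + b * x + b - b * x = b * (1 - b * x) := by ring
  have t1 : 1 - (-b ^ 2 * x + b * x + b) = (1 - b) * (1 - b * x) := by ring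
  have hae : a ≠ e := hne_of hfa he
    (sub_ne_zero.1 (tb ▸ mul_ne_zero (mul_ne_zero hb0 hx0) s1)).symm
  have hce : c ≠ e := hne_of hc he (sub_ne_zero.1 (tbx ▸ mul_ne_zero hb0 s2)).symm
  have he1 : e ≠ 1 := hne_of he h1 (sub_ne_zero.1 (t1 ▸ mul_ne_zero s1 s2)).symm
  refine ⟨e, ?_, by simp [fmap, he]⟩
  refine mem_of_crossRatio_mem _ ha hcK (one_mem _) hac ha1 hce hc1 (Subfield.subset_closure ?_)
  refine (hf (some a) (some c) (some e) (some 1) (by simpa using hac) (by simpa using hae)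
    (by simpa using ha1) (by simpa using hce) (by simpa using hc1) (by simpa using he1)).2 ?_
  rw [hfa, hc, he, h1]
  have hcr : crossRatio (some b) (some (b * x)) (some (-b ^ 2 * x + b * x + b)) (some 1) = x := by
    simp only [crossRatio]
    rw [tb, tbx]
    field_simp
  rwa [hcr]
end

section
/- Let F be a field and let f be an O-preserving permutation of F ∪ {∞}, for some nonempty O ⊆ F \ {0,1} which is Aut(F)-invariant. If char(F) = 2, assume further that O is closed under taking square roots. Then f sends K-chains to K-chains, where K = k(O) is the subfield generated by O over the prime field k of F. -/
open scoped Classical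

/-- The map `x ↦ (a σ(x) + b)/(c σ(x) + d)` on the projective line `F ∪ {∞}`,
with the usual conventions at `∞`. -/
noncomputable def moebius {F : Type*} [Field F] (σ : F ≃+* F) (a b c d : F) :
    Option F → Option F
  | none => if c = 0 then none else some (a / c)
  | some x => if c * σ x + d = 0 then none else some ((a * σ x + b) / (c * σ x + d))

/-- `PΓL₂(F)`: the group of permutations of the projective line `F ∪ {∞}` of the
form `x ↦ (a σ(x) + b)/(c σ(x) + d)` with `ad - bc ≠ 0` and `σ ∈ Aut(F)`. -/
def PGammaL2 (F : Type*) [Field F] : Set (Equiv.Perm (Option F)) :=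
  {f | ∃ (σ : F ≃+* F) (a b c d : F), a * d - b * c ≠ 0 ∧
        ∀ x, f x = moebius σ a b c d x}

/-- A `K`-chain: the image of `K ∪ {∞}` under an element of `PΓL₂(F)`. -/
def IsKChain {F : Type*} [Field F] (K : Subfield F) (X : Set (Option F)) : Prop :=
  ∃ g ∈ PGammaL2 F, X = ⇑g '' (some '' (K : Set F) ∪ {none})

/-- The point of the projective line with homogeneous coordinates `(u : v)`. -/
noncomputable def ofHomog {F : Type*} [Field F] (u v : F) : Option F :=
  if v = 0 then none else some (u / v)

section Homogeneous

variable {F : Type*} [Field F]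

lemma exists_eq_ofHomog (K : Subfield F) (p : Option F)
    (hp : p ∈ some '' (K : Set F) ∪ {none}) :
    ∃ u ∈ K, ∃ v ∈ K, (u ≠ 0 ∨ v ≠ 0) ∧ p = ofHomog u v := by
  rcases hp with ⟨x, hx, rfl⟩ | rfl
  · exact ⟨x, hx, 1, K.one_mem, by simp, by simp [ofHomog]⟩
  · exact ⟨1, K.one_mem, 0, K.zero_mem, by simp, by simp [ofHomog]⟩

lemma exists_homog (p : Option F) :
    ∃ u v : F, (u ≠ 0 ∨ v ≠ 0) ∧ p = ofHomog u v := by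
  obtain ⟨u, -, v, -, h⟩ := exists_eq_ofHomog (⊤ : Subfield F) p (by cases p <;> simp)
  exact ⟨u, v, h⟩

lemma ofHomog_eq_iff {u v u' v' : F} (h : u ≠ 0 ∨ v ≠ 0) (h' : u' ≠ 0 ∨ v' ≠ 0) :
    ofHomog u v = ofHomog u' v' ↔ u * v' - u' * v = 0 := by
  unfold ofHomog
  by_cases hv : v = 0 <;> by_cases hv' : v' = 0
  · simp [hv, hv']
  · simp_all
  · simp_all
  · simp only [hv, hv', if_false, Option.some.injEq, div_eq_div_iff hv hv', sub_eq_zero]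

lemma crossRatio_ofHomog {a₁ a₂ b₁ b₂ c₁ c₂ d₁ d₂ : F}
    (hab : a₁ * b₂ - b₁ * a₂ ≠ 0) (hac : a₁ * c₂ - c₁ * a₂ ≠ 0)
    (had : a₁ * d₂ - d₁ * a₂ ≠ 0) (hbc : b₁ * c₂ - c₁ * b₂ ≠ 0)
    (hbd : b₁ * d₂ - d₁ * b₂ ≠ 0) (hcd : c₁ * d₂ - d₁ * c₂ ≠ 0) :
    crossRatio (ofHomog a₁ a₂) (ofHomog b₁ b₂) (ofHomog c₁ c₂) (ofHomog d₁ d₂) =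
      ((a₁ * c₂ - c₁ * a₂) * (b₁ * d₂ - d₁ * b₂)) /
        ((b₁ * c₂ - c₁ * b₂) * (a₁ * d₂ - d₁ * a₂)) := by
  have sub_div_ne {x y z w : F} (hy : y ≠ 0) (hw : w ≠ 0) :
      z / w - x / y = -(x * w - z * y) / (w * y) := by
    field_simp
    ring
  unfold ofHomog
  by_cases ha : a₂ = 0
  · subst ha
    simp only [mul_zero, sub_zero, mul_ne_zero_iff] at hab hac had
    simp only [hab.2, hac.2, had.2, if_true, if_false, crossRatio]
    rw [sub_div_ne hab.2 had.2, sub_div_ne hab.2 hac.2]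
    have := hab.2; have := hac.1; have := hac.2; have := had.2
    field_simp
    ring
  by_cases hb : b₂ = 0
  · subst hb
    simp only [mul_zero, zero_sub, sub_zero, neg_ne_zero, mul_ne_zero_iff] at hab hbc hbd
    simp only [ha, hbc.2, hbd.2, if_true, if_false, crossRatio]
    rw [sub_div_ne ha hbd.2, sub_div_ne ha hbc.2]
    have := hbc.2; have := hbc.1; have := hbd.2
    field_simp
    ring
  by_cases hc : c₂ = 0
  · subst hc
    simp only [mul_zero, zero_sub, sub_zero, neg_ne_zero, mul_ne_zero_iff] at hac hbc hcd
    simp only [ha, hb, hcd.2, if_true, if_false, crossRatio]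
    rw [sub_div_ne ha hcd.2, sub_div_ne hb hcd.2]
    have := hcd.2; have := hcd.1
    field_simp
    ring
  by_cases hd : d₂ = 0
  · subst hd
    simp only [mul_zero, zero_sub, neg_ne_zero, mul_ne_zero_iff] at had hbd hcd
    simp only [ha, hb, hc, if_true, if_false, crossRatio]
    rw [sub_div_ne ha hc, sub_div_ne hb hc]
    have := hcd.1
    field_simp
    ring
  · simp only [ha, hb, hc, hd, if_false, crossRatio]
    rw [sub_div_ne ha hc, sub_div_ne hb hc, sub_div_ne ha hd, sub_div_ne hb hd]
    field_simp

lemma moebius_ofHomog (σ : F ≃+* F) (a b c d : F) {u v : F} (h : u ≠ 0 ∨ v ≠ 0) :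
    moebius σ a b c d (ofHomog u v) =
      ofHomog (a * σ u + b * σ v) (c * σ u + d * σ v) := by
  unfold ofHomog
  by_cases hv : v = 0
  · have hu : σ u ≠ 0 := by simpa [hv] using h
    by_cases hc : c = 0
    · simp [hv, hc, moebius]
    · simp [hv, hc, moebius, hu, mul_div_mul_right]
  · have hv' : σ v ≠ 0 := by simpa using hv
    have e : c * σ (u / v) + d = (c * σ u + d * σ v) / σ v := by
      rw [map_div₀]; field_simp
    have e' : a * σ (u / v) + b = (a * σ u + b * σ v) / σ v := by
      rw [map_div₀]; field_simp
    simp only [hv, if_false, moebius, e, e', div_eq_zero_iff, hv', or_false]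
    split_ifs
    · rfl
    · rw [div_div_div_cancel_right₀ hv']

lemma linear_ne_zero {a b c d u v : F} (hdet : a * d - b * c ≠ 0) (h : u ≠ 0 ∨ v ≠ 0) :
    a * u + b * v ≠ 0 ∨ c * u + d * v ≠ 0 := by
  by_contra! h'
  have hu : (a * d - b * c) * u = 0 := by linear_combination d * h'.1 - b * h'.2
  have hv : (a * d - b * c) * v = 0 := by linear_combination a * h'.2 - c * h'.1
  simp_all

lemma crossRatio_moebius (σ : F ≃+* F) {a b c d : F} (hdet : a * d - b * c ≠ 0)
    {p q r s : Option F} (hpq : p ≠ q) (hpr : p ≠ r) (hps : p ≠ s)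
    (hqr : q ≠ r) (hqs : q ≠ s) (hrs : r ≠ s) :
    crossRatio (moebius σ a b c d p) (moebius σ a b c d q)
      (moebius σ a b c d r) (moebius σ a b c d s) = σ (crossRatio p q r s) := by
  obtain ⟨p₁, p₂, hp, rfl⟩ := exists_homog p
  obtain ⟨q₁, q₂, hq, rfl⟩ := exists_homog q
  obtain ⟨r₁, r₂, hr, rfl⟩ := exists_homog r
  obtain ⟨s₁, s₂, hs, rfl⟩ := exists_homog s
  rw [Ne, ofHomog_eq_iff ‹_› ‹_›] at hpq hpr hps hqr hqs hrs
  have key (x y z w : F) : (a * σ x + b * σ y) * (c * σ z + d * σ w) -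
      (a * σ z + b * σ w) * (c * σ x + d * σ y) = (a * d - b * c) * σ (x * w - z * y) := by
    simp only [map_sub, map_mul]
    ring
  have key_ne {x y z w : F} (h : x * w - z * y ≠ 0) :
      (a * σ x + b * σ y) * (c * σ z + d * σ w) -
      (a * σ z + b * σ w) * (c * σ x + d * σ y) ≠ 0 := by
    rw [key]
    exact mul_ne_zero hdet (by rwa [Ne, map_eq_zero])
  simp only [moebius_ofHomog σ a b c d, hp, hq, hr, hs]
  rw [crossRatio_ofHomog (key_ne hpq) (key_ne hpr) (key_ne hps) (key_ne hqr) (key_ne hqs)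
    (key_ne hrs), crossRatio_ofHomog hpq hpr hps hqr hqs hrs]
  simp only [key, map_div₀, map_mul]
  rw [mul_mul_mul_comm, mul_mul_mul_comm (a * d - b * c) (σ (q₁ * r₂ - r₁ * q₂)),
    mul_div_mul_left _ _ (mul_ne_zero hdet hdet)]

lemma moebius_adjugate {a b c d : F} (hdet : a * d - b * c ≠ 0) (p : Option F) :
    moebius (RingEquiv.refl F) d (-b) (-c) a (moebius (RingEquiv.refl F) a b c d p) = p := by
  obtain ⟨u, v, h, rfl⟩ := exists_homog p
  have h₁ : a * u + b * v ≠ 0 ∨ c * u + d * v ≠ 0 := linear_ne_zero hdet h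
  have h₂ := linear_ne_zero (a := d) (b := -b) (c := -c) (d := a)
    (by convert hdet using 1; ring) h₁
  rw [moebius_ofHomog _ _ _ _ _ h]
  simp only [RingEquiv.refl_apply]
  rw [moebius_ofHomog _ _ _ _ _ h₁]
  simp only [RingEquiv.refl_apply]
  rw [ofHomog_eq_iff h₂ h]
  ring

/-- The permutation `x ↦ (a x + b) / (c x + d)` of the projective line. -/
noncomputable def moebiusPerm (a b c d : F) (hdet : a * d - b * c ≠ 0) :
    Equiv.Perm (Option F) where
  toFun := moebius (RingEquiv.refl F) a b c d
  invFun := moebius (RingEquiv.refl F) d (-b) (-c) a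
  left_inv := moebius_adjugate hdet
  right_inv p := by
    simpa using moebius_adjugate (a := d) (b := -b) (c := -c) (d := a)
      (by convert hdet using 1; ring) p

lemma moebiusPerm_mem (a b c d : F) (hdet : a * d - b * c ≠ 0) :
    moebiusPerm a b c d hdet ∈ PGammaL2 F :=
  ⟨RingEquiv.refl F, a, b, c, d, hdet, fun _ => rfl⟩

lemma exists_mem_PGammaL2_of_ne {p q r : Option F} (hpq : p ≠ q) (hpr : p ≠ r) (hqr : q ≠ r) :
    ∃ h ∈ PGammaL2 F, h none = p ∧ h (some 0) = q ∧ h (some 1) = r := by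
  obtain ⟨p₁, p₂, hp, rfl⟩ := exists_homog p
  obtain ⟨q₁, q₂, hq, rfl⟩ := exists_homog q
  obtain ⟨r₁, r₂, hr, rfl⟩ := exists_homog r
  rw [Ne, ofHomog_eq_iff ‹_› ‹_›] at hpq hpr hqr
  set l := q₁ * r₂ - r₁ * q₂ with hl
  set m := p₁ * r₂ - r₁ * p₂ with hm
  have hdet : (-l * p₁) * (m * q₂) - (m * q₁) * (-l * p₂) ≠ 0 := by
    have : (-l * p₁) * (m * q₂) - (m * q₁) * (-l * p₂) = -l * m * (p₁ * q₂ - q₁ * p₂) := by ring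
    rw [this]
    exact mul_ne_zero (mul_ne_zero (neg_ne_zero.mpr hqr) hpr) hpq
  have e₀ : (none : Option F) = ofHomog 1 0 := by simp [ofHomog]
  have e₁ (x : F) : some x = ofHomog x 1 := by simp [ofHomog]
  refine ⟨_, moebiusPerm_mem (-l * p₁) (m * q₁) (-l * p₂) (m * q₂) hdet, ?_, ?_, ?_⟩
  · have h : (1 : F) ≠ 0 ∨ (0 : F) ≠ 0 := by simp
    have h' := linear_ne_zero hdet h
    change moebius (RingEquiv.refl F) (-l * p₁) (m * q₁) (-l * p₂) (m * q₂) none = _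
    rw [e₀, moebius_ofHomog _ _ _ _ _ h]
    simp only [RingEquiv.refl_apply]
    rw [ofHomog_eq_iff h' hp]
    ring
  · have h : (0 : F) ≠ 0 ∨ (1 : F) ≠ 0 := by simp
    have h' := linear_ne_zero hdet h
    change moebius (RingEquiv.refl F) (-l * p₁) (m * q₁) (-l * p₂) (m * q₂) (some 0) = _
    rw [e₁, moebius_ofHomog _ _ _ _ _ h]
    simp only [RingEquiv.refl_apply]
    rw [ofHomog_eq_iff h' hq]
    ring
  · have h : (1 : F) ≠ 0 ∨ (1 : F) ≠ 0 := by simp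
    have h' := linear_ne_zero hdet h
    change moebius (RingEquiv.refl F) (-l * p₁) (m * q₁) (-l * p₂) (m * q₂) (some 1) = _
    rw [e₁, moebius_ofHomog _ _ _ _ _ h]
    simp only [RingEquiv.refl_apply]
    rw [ofHomog_eq_iff h' hr]
    simp only [hl, hm]
    ring

/-- The fourth point of a quadruple is rational over any subfield containing the cross-ratio
and over which the first three points are rational. -/
lemma mem_chain_of_crossRatio_mem (K : Subfield F) {a b c d : Option F}
    (hab : a ≠ b) (hac : a ≠ c) (had : a ≠ d) (hbc : b ≠ c) (hbd : b ≠ d) (hcd : c ≠ d)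
    (ha : a ∈ some '' (K : Set F) ∪ {none}) (hb : b ∈ some '' (K : Set F) ∪ {none})
    (hc : c ∈ some '' (K : Set F) ∪ {none}) (h : crossRatio a b c d ∈ K) :
    d ∈ some '' (K : Set F) ∪ {none} := by
  obtain ⟨a₁, ha₁, a₂, ha₂, ha, rfl⟩ := exists_eq_ofHomog K a ha
  obtain ⟨b₁, hb₁, b₂, hb₂, hb, rfl⟩ := exists_eq_ofHomog K b hb
  obtain ⟨c₁, hc₁, c₂, hc₂, hc, rfl⟩ := exists_eq_ofHomog K c hc
  cases d with
  | none => simp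
  | some x =>
    have e : some x = ofHomog x 1 := by simp [ofHomog]
    have hx : x ≠ 0 ∨ (1 : F) ≠ 0 := by simp
    rw [e] at had hbd hcd h
    rw [Ne, ofHomog_eq_iff ‹_› ‹_›] at hab hac had hbc hbd hcd
    rw [crossRatio_ofHomog hab hac had hbc hbd hcd] at h
    set o := ((a₁ * c₂ - c₁ * a₂) * (b₁ * 1 - x * b₂)) /
        ((b₁ * c₂ - c₁ * b₂) * (a₁ * 1 - x * a₂)) with ho
    rw [eq_div_iff (mul_ne_zero hbc had)] at ho
    set l := o * (b₁ * c₂ - c₁ * b₂) with hl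
    set m := a₁ * c₂ - c₁ * a₂ with hm
    have hmK : m ∈ K := K.sub_mem (K.mul_mem ha₁ hc₂) (K.mul_mem hc₁ ha₂)
    have hlK : l ∈ K := K.mul_mem h (K.sub_mem (K.mul_mem hb₁ hc₂) (K.mul_mem hc₁ hb₂))
    have hlin : x * (l * a₂ - m * b₂) = l * a₁ - m * b₁ := by
      rw [hl]
      linear_combination -ho
    have hne : l * a₂ - m * b₂ ≠ 0 := by
      intro h0
      have h1 : l * a₁ - m * b₁ = 0 := by rw [← hlin, h0, mul_zero]
      have : m * (a₁ * b₂ - b₁ * a₂) = 0 := by linear_combination a₂ * h1 - a₁ * h0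
      exact mul_ne_zero hac hab this
    left
    refine ⟨x, ?_, rfl⟩
    rw [eq_div_of_mul_eq hne hlin]
    exact K.div_mem (K.sub_mem (K.mul_mem hlK ha₁) (K.mul_mem hmK hb₁))
      (K.sub_mem (K.mul_mem hlK ha₂) (K.mul_mem hmK hb₂))

end Homogeneous

section Preserving

variable {F : Type*} [Field F] {O : Set F}

lemma OPreserving.mul {f g : Equiv.Perm (Option F)} (hf : OPreserving O f)
    (hg : OPreserving O g) : OPreserving O (f * g) := fun a b c d hab hac had hbc hbd hcd =>
  (hg a b c d hab hac had hbc hbd hcd).trans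
    (hf _ _ _ _ (g.injective.ne hab) (g.injective.ne hac) (g.injective.ne had)
      (g.injective.ne hbc) (g.injective.ne hbd) (g.injective.ne hcd))

lemma OPreserving.inv {f : Equiv.Perm (Option F)} (hf : OPreserving O f) :
    OPreserving O f⁻¹ := fun a b c d hab hac had hbc hbd hcd => by
  have hi := (f⁻¹).injective
  simpa using (hf (f⁻¹ a) (f⁻¹ b) (f⁻¹ c) (f⁻¹ d) (hi.ne hab) (hi.ne hac) (hi.ne had)
    (hi.ne hbc) (hi.ne hbd) (hi.ne hcd)).symm

lemma OPreserving.of_mem_PGammaL2 (hInv : ∀ σ : F ≃+* F, ∀ x ∈ O, σ x ∈ O)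
    {g : Equiv.Perm (Option F)} (hg : g ∈ PGammaL2 F) : OPreserving O g := by
  obtain ⟨σ, a, b, c, d, hdet, h⟩ := hg
  intro p q r s hpq hpr hps hqr hqs hrs
  rw [h, h, h, h, crossRatio_moebius σ hdet hpq hpr hps hqr hqs hrs]
  exact ⟨hInv σ _, fun hx => by simpa using hInv σ.symm _ hx⟩

lemma OPreserving.moebiusPerm {a b c d : F} (hdet : a * d - b * c ≠ 0) :
    OPreserving O (moebiusPerm a b c d hdet) := by
  intro p q r s hpq hpr hps hqr hqs hrs
  exact iff_of_eq (congrArg (· ∈ O)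
    (crossRatio_moebius (RingEquiv.refl F) hdet hpq hpr hps hqr hqs hrs).symm)

/-- The smallest set containing `∞, 0, 1` and every point whose cross-ratio with three points
of the set belongs to `O`. -/
inductive CrossClosure (O : Set F) : Option F → Prop
  | infty : CrossClosure O none
  | zero : CrossClosure O (some 0)
  | one : CrossClosure O (some 1)
  | step (a b c d : Option F) (hab : a ≠ b) (hac : a ≠ c) (had : a ≠ d) (hbc : b ≠ c)
      (hbd : b ≠ d) (hcd : c ≠ d) (ha : CrossClosure O a) (hb : CrossClosure O b)
      (hc : CrossClosure O c) (h : crossRatio a b c d ∈ O) : CrossClosure O d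

namespace CrossClosure

lemma map {f : Equiv.Perm (Option F)} (hf : OPreserving O f) (h_infty : CrossClosure O (f none))
    (h_zero : CrossClosure O (f (some 0))) (h_one : CrossClosure O (f (some 1)))
    {p : Option F} (hp : CrossClosure O p) : CrossClosure O (f p) := by
  induction hp with
  | infty => exact h_infty
  | zero => exact h_zero
  | one => exact h_one
  | step a b c d hab hac had hbc hbd hcd _ _ _ h ha hb hc =>
    exact step (f a) (f b) (f c) (f d) (f.injective.ne hab) (f.injective.ne hac)
      (f.injective.ne had) (f.injective.ne hbc) (f.injective.ne hbd) (f.injective.ne hcd)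
      ha hb hc ((hf a b c d hab hac had hbc hbd hcd).mp h)

lemma mul {s x : F} (hs : CrossClosure O (some s)) (hx : CrossClosure O (some x)) :
    CrossClosure O (some (s * x)) := by
  by_cases h0 : s = 0
  · simpa [h0] using zero
  have hdet : s * 1 - 0 * 0 ≠ 0 := by simpa using h0
  have := map (OPreserving.moebiusPerm (O := O) hdet)
    (by simpa [moebiusPerm, moebius] using infty) (by simpa [moebiusPerm, moebius] using zero)
    (by simpa [moebiusPerm, moebius] using hs) hx
  simpa [moebiusPerm, moebius] using this

lemma inv {x : F} (hx : CrossClosure O (some x)) : CrossClosure O (some x⁻¹) := by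
  by_cases h0 : x = 0
  · simpa [h0] using zero
  have hdet : (0 : F) * 0 - 1 * 1 ≠ 0 := by simp
  have := map (OPreserving.moebiusPerm (O := O) hdet)
    (by simpa [moebiusPerm, moebius] using zero) (by simpa [moebiusPerm, moebius] using infty)
    (by simpa [moebiusPerm, moebius] using one) hx
  simpa [moebiusPerm, moebius, h0] using this

lemma one_sub {x : F} (hx : CrossClosure O (some x)) : CrossClosure O (some (1 - x)) := by
  have hdet : (-1 : F) * 1 - 1 * 0 ≠ 0 := by simp
  have := map (OPreserving.moebiusPerm (O := O) hdet)
    (by simpa [moebiusPerm, moebius] using infty) (by simpa [moebiusPerm, moebius] using one)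
    (by simpa [moebiusPerm, moebius] using zero) hx
  simpa [moebiusPerm, moebius, sub_eq_neg_add] using this

lemma sub_of_ne_zero {x y : F} (h0 : x ≠ 0) (hx : CrossClosure O (some x))
    (hy : CrossClosure O (some y)) : CrossClosure O (some (x - y)) := by
  have := hx.mul (hx.inv.mul hy).one_sub
  rwa [show x * (1 - x⁻¹ * y) = x - y by field_simp] at this

lemma of_mem (hO : ∀ x ∈ O, x ≠ 0 ∧ x ≠ 1) {o : F} (ho : o ∈ O) : CrossClosure O (some o) :=
  step none (some 0) (some 1) (some o) (by simp) (by simp) (by simp) (by simp)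
    (by simpa using (hO o ho).1.symm) (by simpa using (hO o ho).2.symm) infty zero one
    (by simpa [crossRatio] using ho)

lemma neg (hne : O.Nonempty) (hO : ∀ x ∈ O, x ≠ 0 ∧ x ≠ 1) {x : F}
    (hx : CrossClosure O (some x)) : CrossClosure O (some (-x)) := by
  obtain ⟨o, ho⟩ := hne
  obtain ⟨h0, h1⟩ := hO o ho
  have hoc := of_mem hO ho
  have h1' : 1 - o ≠ 0 := sub_ne_zero.mpr h1.symm
  have := ((sub_of_ne_zero h0 hoc one).mul hoc.one_sub.inv).mul hx
  rwa [show (o - 1) * (1 - o)⁻¹ * x = -x by field_simp; ring] at this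

lemma add (hne : O.Nonempty) (hO : ∀ x ∈ O, x ≠ 0 ∧ x ≠ 1) {x y : F}
    (hx : CrossClosure O (some x)) (hy : CrossClosure O (some y)) :
    CrossClosure O (some (x + y)) := by
  by_cases h0 : x = 0
  · simpa [h0] using hy
  · simpa using sub_of_ne_zero h0 hx (hy.neg hne hO)

end CrossClosure

lemma crossClosure_iff (hne : O.Nonempty) (hO : ∀ x ∈ O, x ≠ 0 ∧ x ≠ 1) (p : Option F) :
    CrossClosure O p ↔ p ∈ some '' (Subfield.closure O : Set F) ∪ {none} := by
  constructor
  · intro hp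
    induction hp with
    | infty => simp
    | zero => simp
    | one => simp
    | step a b c d hab hac had hbc hbd hcd _ _ _ h ha hb hc =>
      exact mem_chain_of_crossRatio_mem _ hab hac had hbc hbd hcd ha hb hc
        (Subfield.subset_closure h)
  · rintro (⟨x, hx, rfl⟩ | rfl)
    · induction hx using Subfield.closure_induction with
      | mem x hx => exact CrossClosure.of_mem hO hx
      | one => exact CrossClosure.one
      | add x y _ _ hx hy => exact hx.add hne hO hy
      | neg x _ hx => exact hx.neg hne hO
      | inv x _ hx => exact hx.inv
      | mul x y _ _ hx hy => exact hx.mul hy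
    · exact CrossClosure.infty

lemma OPreserving.isKChain_image (hne : O.Nonempty) (hO : ∀ x ∈ O, x ≠ 0 ∧ x ≠ 1)
    (hInv : ∀ σ : F ≃+* F, ∀ x ∈ O, σ x ∈ O) {f : Equiv.Perm (Option F)}
    (hf : OPreserving O f) :
    IsKChain (Subfield.closure O)
      (f '' (some '' (Subfield.closure O : Set F) ∪ {none})) := by
  have hC : some '' (Subfield.closure O : Set F) ∪ {none} = {p | CrossClosure O p} :=
    Set.ext fun p => (crossClosure_iff hne hO p).symm
  obtain ⟨h, hmem, h_infty, h_zero, h_one⟩ := exists_mem_PGammaL2_of_ne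
    (p := f none) (q := f (some 0)) (r := f (some 1)) (by simp) (by simp) (by simp)
  have hh := OPreserving.of_mem_PGammaL2 hInv hmem
  refine ⟨h, hmem, ?_⟩
  rw [hC]
  apply Set.Subset.antisymm
  · rintro _ ⟨p, hp, rfl⟩
    refine ⟨(h⁻¹ * f) p, CrossClosure.map (hh.inv.mul hf) ?_ ?_ ?_ hp, by simp⟩
    · simpa [← h_infty] using CrossClosure.infty
    · simpa [← h_zero] using CrossClosure.zero
    · simpa [← h_one] using CrossClosure.one
  · rintro _ ⟨p, hp, rfl⟩
    refine ⟨(f⁻¹ * h) p, CrossClosure.map (hf.inv.mul hh) ?_ ?_ ?_ hp, by simp⟩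
    · simpa [h_infty] using CrossClosure.infty
    · simpa [h_zero] using CrossClosure.zero
    · simpa [h_one] using CrossClosure.one

end Preserving

/-- An `O`-preserving permutation (`O` nonempty, `Aut(F)`-invariant, contained in
`F \ {0,1}`, and closed under square roots if `char F = 2`) sends `K`-chains to
`K`-chains, where `K = k(O)` is the subfield generated by `O`. -/
theorem O_preserving_sends_chains_to_chains {F : Type*} [Field F]
    (O : Set F) (hne : O.Nonempty) (hO : ∀ x ∈ O, x ≠ 0 ∧ x ≠ 1)
    (hInv : ∀ σ : F ≃+* F, ∀ x ∈ O, σ x ∈ O)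
    (f : Equiv.Perm (Option F)) (hf : OPreserving O f)
    (hsqrt : ringChar F = 2 → ∀ x ∈ O, ∀ y : F, y ^ 2 = x → y ∈ O) :
    ∀ X : Set (Option F), IsKChain (Subfield.closure O) X →
      IsKChain (Subfield.closure O) (⇑f '' X) := by
  rintro _ ⟨g, hg, rfl⟩
  have h := (hf.mul (OPreserving.of_mem_PGammaL2 hInv hg)).isKChain_image hne hO hInv
  rwa [Equiv.Perm.coe_mul, Set.image_comp] at h
end
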